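/- Let γ ≤ 0 and suppose S ≤ 0. Then Z ≥ γ if and only if (1 + γ²/n)·S² − γ²·Q ≤ 0. (Case 2 of the feasibility reformulation of the maximization Z-test.) -/

import Mathlib

theorem stmt_5 (n : ℕ) (hn : 1 ≤ n) (t : Fin n → ℝ)
    (S Q σ Z : ℝ)
    (hS : S = ∑ k, t k) (hQ : Q = ∑ k, (t k) ^ 2)
    (hσ : σ = Real.sqrt (Q / n - (S / n) ^ 2)) (hσpos : 0 < σ)
    (hZ : Z = S / (Real.sqrt n * σ))
    (γ : ℝ) (hγ : γ ≤ 0) (hSneg : S ≤ 0) :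
    γ ≤ Z ↔ (1 + γ ^ 2 / n) * S ^ 2 - γ ^ 2 * Q ≤ 0 := by
  have hn0 : (0 : ℝ) < n := by exact_mod_cast hn
  have hσ2 : σ ^ 2 = Q / n - (S / n) ^ 2 := by
    rw [hσ] at hσpos ⊢
    exact Real.sq_sqrt (Real.sqrt_pos.mp hσpos).le
  have hd : 0 < Real.sqrt n * σ := mul_pos (Real.sqrt_pos.mpr hn0) hσpos
  have hd2 : (Real.sqrt n * σ) ^ 2 = Q - S ^ 2 / n := by
    rw [mul_pow, Real.sq_sqrt hn0.le, hσ2]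
    field_simp
  generalize Real.sqrt n * σ = d at *
  have key : (1 + γ ^ 2 / n) * S ^ 2 - γ ^ 2 * Q = S ^ 2 - (γ * d) ^ 2 := by
    rw [mul_pow, hd2]
    ring
  have hγd : γ * d ≤ 0 := mul_nonpos_of_nonpos_of_nonneg hγ hd.le
  rw [key, hZ, le_div_iff₀ hd, sub_nonpos, sq_le_sq, abs_of_nonpos hSneg, abs_of_nonpos hγd,
    neg_le_neg_iff]
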